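/- Let a ≥ 1, b ≥ 0, let L = U^a ⊕ E₈(−1)^b and M = L ⊕ U, where the last hyperbolic summand U has basis f, e with ⟨f,f⟩ = ⟨e,e⟩ = 0 and ⟨f,e⟩ = 1; write elements of M as (v,m,n) = v + m f + n e with v ∈ L, m,n ∈ ℤ (so ⟨(v,m,n), e⟩ = m). Let R₁ = {δ ∈ M : ⟨δ,δ⟩ = −2 and ⟨δ,e⟩ = 1} and let Γ₁ be the subgroup of O(M) generated by −id and the reflections s_δ(x) = x + ⟨x,δ⟩δ for δ ∈ R₁. Then every vector r ∈ M is conjugate under Γ₁ to a vector (v,m,n) such that either m = 0, or m > 0 and v ∈ mL (i.e. v = m·w for some w ∈ L). -/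

import Mathlib

noncomputable section

open scoped BigOperators

/-- Index type for the even unimodular lattice `L = U^a ⊕ E₈(-1)^b`. -/
abbrev LIdx (a b : ℕ) := (Fin a × Fin 2) ⊕ (Fin b × Fin 8)

/-- Elements of the lattice `L = U^a ⊕ E₈(-1)^b`. -/
abbrev LVec (a b : ℕ) := LIdx a b → ℤ

/-- The Gram matrix of `U^a ⊕ E₈(-1)^b`. -/
def gramL (a b : ℕ) : LIdx a b → LIdx a b → ℤ := fun i j =>
  match i, j with
  | Sum.inl (k, s), Sum.inl (k', s') => if k = k' ∧ s ≠ s' then 1 else 0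
  | Sum.inr (k, s), Sum.inr (k', s') => if k = k' then -(CartanMatrix.E₈ s s') else 0
  | _, _ => 0

/-- The bilinear form of `L = U^a ⊕ E₈(-1)^b`. -/
def BL (a b : ℕ) (x y : LVec a b) : ℤ :=
  ∑ i, ∑ j, x i * gramL a b i j * y j

/-- Index type for `M = L ⊕ U`; the extra hyperbolic summand has basis `f = inr 0`,
`e = inr 1`.  An element `v + m f + n e` of `M` is the function sending `inl i` to `v i`,
`inr 0` to `m` and `inr 1` to `n`. -/
abbrev MIdx (a b : ℕ) := LIdx a b ⊕ Fin 2

/-- Elements of `M = L ⊕ U`. -/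
abbrev MVec (a b : ℕ) := MIdx a b → ℤ

/-- The bilinear form of `M = L ⊕ U`: `⟨v + m f + n e, v' + m' f + n' e⟩
  = ⟨v,v'⟩_L + m n' + n m'`. -/
def BM (a b : ℕ) (x y : MVec a b) : ℤ :=
  BL a b (fun i => x (Sum.inl i)) (fun i => y (Sum.inl i)) +
    x (Sum.inr 0) * y (Sum.inr 1) + x (Sum.inr 1) * y (Sum.inr 0)

/-- The basis vector `e` of the last hyperbolic summand of `M = L ⊕ U`. -/
def eM (a b : ℕ) : MVec a b := fun i => if i = Sum.inr 1 then 1 else 0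

/-- The subgroup `Γ₁` of `O(M)` generated by `-id` and the reflections
`s_δ : x ↦ x + ⟨x,δ⟩δ` in the norm `-2` vectors `δ` with `⟨δ,e⟩ = 1`. -/
def Gamma1 (a b : ℕ) : Subgroup (MVec a b ≃ₗ[ℤ] MVec a b) :=
  Subgroup.closure
    ({σ | ∀ x, σ x = -x} ∪
      {σ | ∃ δ : MVec a b, BM a b δ δ = -2 ∧ BM a b δ (eM a b) = 1 ∧
        ∀ x, σ x = x + BM a b x δ • δ})

/-- The root `i u + j u' + f - (1 + i j) e`, where `u, u'` is the standard basis of the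
hyperbolic summand of `L` with index `z`. -/
def hyperbolicRoot {a : ℕ} (b : ℕ) (z : Fin a) (i j : ℤ) : MVec a b :=
  Sum.elim (Pi.single (Sum.inl (z, 0)) i + Pi.single (Sum.inl (z, 1)) j) ![1, -1 - i * j]

theorem BL_hyperbolic {a b : ℕ} (z : Fin a) (i j : ℤ) (x : LVec a b) :
    BL a b x (Pi.single (Sum.inl (z, 0)) i + Pi.single (Sum.inl (z, 1)) j) =
      x (Sum.inl (z, 0)) * j + x (Sum.inl (z, 1)) * i := by
  simp only [BL, Pi.add_apply, mul_add, Finset.sum_add_distrib, Pi.single_apply, mul_ite,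
    mul_zero, Finset.sum_ite_eq', Finset.mem_univ, if_true]
  simp [gramL, Fintype.sum_sum_type, Fintype.sum_prod_type, ite_and, add_comm]

theorem BM_hyperbolicRoot {a b : ℕ} (z : Fin a) (i j : ℤ) (x : MVec a b) :
    BM a b x (hyperbolicRoot b z i j) =
      x (Sum.inl (Sum.inl (z, 0))) * j + x (Sum.inl (Sum.inl (z, 1))) * i +
        x (Sum.inr 0) * (-1 - i * j) + x (Sum.inr 1) := by
  have h := BL_hyperbolic z i j (fun k => x (Sum.inl k))
  have hBM : BM a b x (hyperbolicRoot b z i j) =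
      BL a b (fun k => x (Sum.inl k))
        (Pi.single (Sum.inl (z, 0)) i + Pi.single (Sum.inl (z, 1)) j) +
      x (Sum.inr 0) * (-1 - i * j) + x (Sum.inr 1) * 1 := rfl
  rw [hBM, h, mul_one]

theorem BM_hyperbolicRoot_self {a b : ℕ} (z : Fin a) (i j : ℤ) :
    BM a b (hyperbolicRoot b z i j) (hyperbolicRoot b z i j) = -2 := by
  rw [BM_hyperbolicRoot]
  simp [hyperbolicRoot]
  ring

theorem BM_hyperbolicRoot_eM {a b : ℕ} (z : Fin a) (i j : ℤ) :
    BM a b (hyperbolicRoot b z i j) (eM a b) = 1 := by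
  simp [BM, BL, eM, hyperbolicRoot]

/-- Reflecting in `hyperbolicRoot b z i j` realises one step of the Euclidean algorithm on the
coefficient of `f`. -/
theorem exists_mem_Gamma1_apply_f {a b : ℕ} (z : Fin a) (i j : ℤ) :
    ∃ σ ∈ Gamma1 a b, ∀ x : MVec a b, σ x (Sum.inr 0) =
      (x (Sum.inl (Sum.inl (z, 0))) - x (Sum.inr 0) * i) * j +
        (x (Sum.inl (Sum.inl (z, 1))) * i + x (Sum.inr 1)) := by
  let φ : Module.Dual ℤ (MVec a b) :=
    -(j • LinearMap.proj (Sum.inl (Sum.inl (z, 0))) +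
      i • LinearMap.proj (Sum.inl (Sum.inl (z, 1))) +
      (-1 - i * j) • LinearMap.proj (Sum.inr 0) + LinearMap.proj (Sum.inr 1))
  have hφ (x : MVec a b) : φ x = -BM a b x (hyperbolicRoot b z i j) := by
    rw [BM_hyperbolicRoot]
    simp [φ]
    ring
  have hroot : φ (hyperbolicRoot b z i j) = 2 := by
    rw [hφ, BM_hyperbolicRoot_self, neg_neg]
  have hσ (x : MVec a b) : Module.reflection hroot x =
      x + BM a b x (hyperbolicRoot b z i j) • hyperbolicRoot b z i j := by
    rw [Module.reflection_apply, hφ, neg_smul, sub_neg_eq_add]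
  refine ⟨Module.reflection hroot, Subgroup.subset_closure (Or.inr
    ⟨_, BM_hyperbolicRoot_self z i j, BM_hyperbolicRoot_eM z i j, hσ⟩), fun x => ?_⟩
  rw [hσ, BM_hyperbolicRoot]
  simp [hyperbolicRoot]
  ring

theorem Int.exists_sub_mul_ne_zero_natAbs_le (p : ℤ) {m : ℤ} (hm : m ≠ 0) :
    ∃ i : ℤ, p - m * i ≠ 0 ∧ (p - m * i).natAbs ≤ m.natAbs := by
  have hdiv : p - m * (p / m) = p % m := by rw [Int.emod_def]
  by_cases h : p % m = 0
  · refine ⟨p / m - 1, ?_⟩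
    have : p - m * (p / m - 1) = m := by linear_combination hdiv + h
    rw [this]
    exact ⟨hm, le_rfl⟩
  · refine ⟨p / m, ?_⟩
    rw [hdiv]
    have h₀ := Int.emod_nonneg p hm
    have h₁ := Int.emod_lt_abs p hm
    rw [Int.abs_eq_natAbs] at h₁
    exact ⟨h, by omega⟩

/-- If `L` has a hyperbolic summand, every vector of `M` is conjugate under `Γ₁` to a vector
orthogonal to `e`. -/
theorem exists_mem_Gamma1_apply_f_eq_zero {a b : ℕ} (z : Fin a) (r : MVec a b) :
    ∃ γ ∈ Gamma1 a b, γ r (Sum.inr 0) = 0 := by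
  induction hN : (r (Sum.inr 0)).natAbs using Nat.strong_induction_on generalizing r with
  | _ N ih =>
    by_cases hm : r (Sum.inr 0) = 0
    · exact ⟨1, one_mem _, hm⟩
    obtain ⟨i, hs, hle⟩ :=
      Int.exists_sub_mul_ne_zero_natAbs_le (r (Sum.inl (Sum.inl (z, 0)))) hm
    set s := r (Sum.inl (Sum.inl (z, 0))) - r (Sum.inr 0) * i
    set c := r (Sum.inl (Sum.inl (z, 1))) * i + r (Sum.inr 1) with hc
    obtain ⟨σ, hσ, hσr⟩ := exists_mem_Gamma1_apply_f (b := b) z i (-(c / s))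
    have hrem : σ r (Sum.inr 0) = c % s := by
      rw [hσr, ← hc, Int.emod_def]
      ring
    have h₀ := Int.emod_nonneg c hs
    have h₁ := Int.emod_lt_abs c hs
    rw [Int.abs_eq_natAbs] at h₁
    obtain ⟨γ, hγ, hγr⟩ := ih _ (by omega) (σ r) rfl
    exact ⟨γ * σ, mul_mem hγ hσ, hγr⟩

/-- Every vector of `M = L ⊕ U` is conjugate under `Γ₁` to a vector `v + m f + n e` with
either `m = 0`, or `m > 0` and `v ∈ m L`. -/
theorem statement9 (a b : ℕ) (ha : 1 ≤ a) (r : MVec a b) :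
    ∃ γ ∈ Gamma1 a b,
      γ r (Sum.inr 0) = 0 ∨
      (0 < γ r (Sum.inr 0) ∧
        ∃ w : LVec a b, ∀ i, γ r (Sum.inl i) = γ r (Sum.inr 0) * w i) := by
  obtain ⟨γ, hγ, h⟩ := exists_mem_Gamma1_apply_f_eq_zero ⟨0, ha⟩ r
  exact ⟨γ, hγ, Or.inl h⟩
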